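/- arXiv:math/0212220 — 2 statements merged into one kernel-verified Lean document; each statement's English description precedes it below -/
import Mathlib

section
/- For every integer s ≥ 1 and every integer a one has δ(a,2^s) = 2^{2−s}/3 if a is even, and δ(a,2^s) = 2^{1−s}/3 if a is odd. -/
/-- The double series `δ(a,d)`: the average over primes `p` of the density of elements
of `𝔽_p^*` whose multiplicative order is `≡ a (mod d)`. -/
noncomputable def deltaDensity (a : ℤ) (d : ℕ) : ℝ :=
  ∑' r : ℕ, ∑' m : ℕ,
    if 1 ≤ r ∧ 1 ≤ m ∧ Int.gcd (1 + (r : ℤ) * a) d = 1 ∧ ((Nat.gcd m d : ℤ) ∣ a) then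
      (ArithmeticFunction.moebius m : ℝ) /
        ((m : ℝ) * (r : ℝ) * (Nat.totient (r * Nat.lcm m d) : ℝ))
    else 0

/-- The kernel `μ(m) / (m r φ(2 r m))`, restricted to odd `m`. -/
noncomputable def oddKernel (r m : ℕ) : ℝ :=
  if Odd m then
    (ArithmeticFunction.moebius m : ℝ) / ((m : ℝ) * (r : ℝ) * (Nat.totient (2 * (r * m)) : ℝ))
  else 0

theorem le_totient_sq (n : ℕ) :
    n ≤ 2 * n.totient ^ 2 ∧ (Odd n → n ≤ n.totient ^ 2) := by
  induction n using Nat.recOnPosPrimePosCoprime with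
  | zero => simp
  | one => simp
  | prime_pow p n hp hn =>
    obtain ⟨k, rfl⟩ : ∃ k, n = k + 1 := ⟨n - 1, by omega⟩
    rw [Nat.totient_prime_pow_succ hp]
    have hsq : p ^ k ≤ (p ^ k) ^ 2 := Nat.le_self_pow two_ne_zero _
    have hp2 := hp.two_le
    obtain ⟨q, rfl⟩ : ∃ q, p = q + 2 := ⟨p - 2, by omega⟩
    simp only [show q + 2 - 1 = q + 1 by omega]
    rw [mul_pow, pow_succ]
    refine ⟨?_, fun ho => ?_⟩
    · calc (q + 2) ^ k * (q + 2) ≤ ((q + 2) ^ k) ^ 2 * (2 * (q + 1) ^ 2) :=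
            Nat.mul_le_mul hsq (by nlinarith)
        _ = _ := by ring
    · have hq : q ≠ 0 := by
        rintro rfl
        exact absurd ho (by simp [parity_simps])
      exact Nat.mul_le_mul hsq (by nlinarith [Nat.pos_of_ne_zero hq])
  | coprime a b ha hb hab iha ihb =>
    rw [Nat.totient_mul hab, mul_pow]
    refine ⟨?_, fun ho => ?_⟩
    · rcases Nat.even_or_odd a with h | h
      · have hbo : Odd b := by
          by_contra hbe
          rw [Nat.not_odd_iff_even] at hbe
          exact Nat.not_coprime_of_dvd_of_dvd one_lt_two h.two_dvd hbe.two_dvd hab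
        rw [← mul_assoc]
        exact Nat.mul_le_mul iha.1 (ihb.2 hbo)
      · rw [mul_left_comm]
        exact Nat.mul_le_mul (iha.2 h) ihb.1
    · rw [Nat.odd_mul] at ho
      exact Nat.mul_le_mul (iha.2 ho.1) (ihb.2 ho.2)

theorem summable_one_div_mul_totient :
    Summable fun n : ℕ => 1 / ((n : ℝ) * (n.totient : ℝ)) := by
  have h : Summable fun n : ℕ => 2 * (1 / (n : ℝ) ^ (3 / 2 : ℝ)) :=
    (Real.summable_one_div_nat_rpow.2 (by norm_num)).mul_left 2
  refine Summable.of_nonneg_of_le (fun n => by positivity) (fun n => ?_) h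
  rcases Nat.eq_zero_or_pos n with rfl | hn
  · simp
  have hn' : (0 : ℝ) < n := by exact_mod_cast hn
  have ht : (0 : ℝ) < n.totient := by exact_mod_cast Nat.totient_pos.2 hn
  have hle : (n : ℝ) ≤ 2 * (n.totient : ℝ) ^ 2 := by exact_mod_cast (le_totient_sq n).1
  have hs : √(n : ℝ) ≤ 2 * n.totient := by
    rw [Real.sqrt_le_left (by positivity)]
    nlinarith
  have hpow : (n : ℝ) ^ (3 / 2 : ℝ) = n * √n := by
    rw [Real.sqrt_eq_rpow, show (3 / 2 : ℝ) = 1 + 1 / 2 by norm_num, Real.rpow_add hn',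
      Real.rpow_one]
  have hs0 : 0 < √(n : ℝ) := Real.sqrt_pos.2 hn'
  rw [hpow, mul_one_div, div_le_div_iff₀ (by positivity) (by positivity)]
  nlinarith

theorem abs_oddKernel_le (r m : ℕ) :
    |oddKernel r m| ≤ 1 / ((r : ℝ) * (r.totient : ℝ)) * (1 / ((m : ℝ) * (m.totient : ℝ))) := by
  unfold oddKernel
  split_ifs with h
  · rcases Nat.eq_zero_or_pos r with rfl | hr
    · simp
    have hm := h.pos
    have hmu : |(ArithmeticFunction.moebius m : ℝ)| ≤ 1 := by
      exact_mod_cast ArithmeticFunction.abs_moebius_le_one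
    have hφ : (r.totient : ℝ) * m.totient ≤ (2 * (r * m)).totient := by
      have h1 := Nat.totient_super_multiplicative r m
      have h2 := Nat.totient_super_multiplicative 2 (r * m)
      rw [Nat.totient_two, one_mul] at h2
      exact_mod_cast h1.trans h2
    have hrt : (0 : ℝ) < r.totient := by exact_mod_cast Nat.totient_pos.2 hr
    have hmt : (0 : ℝ) < m.totient := by exact_mod_cast Nat.totient_pos.2 hm
    have hr' : (0 : ℝ) < r := by exact_mod_cast hr
    have hm' : (0 : ℝ) < m := by exact_mod_cast hm
    rw [abs_div, abs_of_nonneg (by positivity : (0 : ℝ) ≤ m * r * (2 * (r * m)).totient),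
      one_div_mul_one_div]
    refine div_le_div₀ zero_le_one hmu (by positivity) ?_
    calc (r : ℝ) * r.totient * (m * m.totient) = m * r * (r.totient * m.totient) := by ring
      _ ≤ _ := by gcongr
  · rw [abs_zero]
    positivity

theorem summable_oddKernel : Summable fun p : ℕ × ℕ => oddKernel p.1 p.2 := by
  refine Summable.of_abs (Summable.of_nonneg_of_le (fun _ => abs_nonneg _)
    (fun p => abs_oddKernel_le p.1 p.2) ?_)
  exact summable_one_div_mul_totient.mul_of_nonneg summable_one_div_mul_totient
    (fun _ => by positivity) (fun _ => by positivity)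

theorem oddKernel_two_mul (r m : ℕ) : oddKernel (2 * r) m = 1 / 4 * oddKernel r m := by
  have h : (2 * (2 * r * m)).totient = 2 * (2 * (r * m)).totient := by
    rw [mul_assoc, Nat.totient_two_mul_of_even (even_two_mul _)]
  unfold oddKernel
  split_ifs
  · rw [h]
    push_cast
    rw [div_mul_div_comm, one_mul]
    congr 1
    ring
  · simp

theorem sum_moebius_snd_divisorsAntidiagonal (n : ℕ) :
    ∑ x ∈ n.divisorsAntidiagonal, (ArithmeticFunction.moebius x.2 : ℝ) =
      if n = 1 then 1 else 0 := by
  have h := congrArg (fun f : ArithmeticFunction ℤ => f n)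
    ArithmeticFunction.coe_zeta_mul_moebius
  simp only [ArithmeticFunction.coe_zeta_mul_apply, ArithmeticFunction.one_apply] at h
  rw [Nat.sum_divisorsAntidiagonal' (fun _ m => (ArithmeticFunction.moebius m : ℝ))]
  exact_mod_cast h

/-- `oddKernel` restricted to odd `r`. -/
noncomputable def oddOddKernel (p : ℕ × ℕ) : ℝ := if Odd p.1 then oddKernel p.1 p.2 else 0

theorem summable_oddOddKernel : Summable oddOddKernel := by
  refine Summable.of_norm_bounded summable_oddKernel.norm fun p => ?_
  unfold oddOddKernel
  split_ifs <;> simp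

theorem sum_oddOddKernel (n : ℕ) :
    ∑ x ∈ n.divisorsAntidiagonal, oddOddKernel x = if n = 1 then 1 else 0 := by
  have h : ∀ x ∈ n.divisorsAntidiagonal, oddOddKernel x =
      (if Odd n then 1 / ((n : ℝ) * n.totient) else 0) * ArithmeticFunction.moebius x.2 := by
    rintro ⟨r, m⟩ hx
    obtain ⟨rfl, -⟩ := Nat.mem_divisorsAntidiagonal.1 hx
    by_cases hr : Odd r <;> by_cases hm : Odd m
    · simp only [oddOddKernel, oddKernel, hr, hm, hr.mul hm, if_true,
        Nat.totient_two_mul_of_odd (hr.mul hm)]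
      push_cast
      ring
    all_goals simp [oddOddKernel, oddKernel, hr, hm, Nat.odd_mul]
  rw [Finset.sum_congr rfl h, ← Finset.mul_sum, sum_moebius_snd_divisorsAntidiagonal]
  split_ifs <;> simp_all

theorem tsum_oddOddKernel : ∑' p, oddOddKernel p = 1 := by
  have hinj : Function.Injective fun p : ℕ+ × ℕ+ => ((p.1 : ℕ), (p.2 : ℕ)) := by
    rintro ⟨a, b⟩ ⟨c, d⟩ h
    simpa using h
  have hsupp : Function.support oddOddKernel ⊆
      Set.range fun p : ℕ+ × ℕ+ => ((p.1 : ℕ), (p.2 : ℕ)) := by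
    rintro ⟨r, m⟩ h
    have hr : Odd r := by
      by_contra hr
      simp [oddOddKernel, hr] at h
    have hm : Odd m := by
      by_contra hm
      simp [oddOddKernel, oddKernel, hm] at h
    exact ⟨(⟨r, hr.pos⟩, ⟨m, hm.pos⟩), rfl⟩
  have hsum := (sigmaAntidiagonalEquivProd.summable_iff.2
    (summable_oddOddKernel.comp_injective hinj)).tsum_sigma
  rw [← hinj.tsum_eq hsupp, ← sigmaAntidiagonalEquivProd.tsum_eq]
  refine hsum.trans ?_
  have hfib (n : ℕ+) : (∑' x : Nat.divisorsAntidiagonal n, ((oddOddKernel ∘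
      fun p : ℕ+ × ℕ+ => ((p.1 : ℕ), (p.2 : ℕ))) ∘ sigmaAntidiagonalEquivProd) ⟨n, x⟩) =
      if n = 1 then 1 else 0 := by
    have h := sum_oddOddKernel n
    rw [← Finset.sum_attach] at h
    rw [tsum_fintype]
    simpa [sigmaAntidiagonalEquivProd, divisorsAntidiagonalFactors] using h
  rw [tsum_congr hfib, tsum_ite_eq]

theorem summable_oddKernel_left (r : ℕ) : Summable (oddKernel r) :=
  summable_oddKernel.prod_factor r

theorem summable_tsum_oddKernel : Summable fun r => ∑' m, oddKernel r m :=
  summable_oddKernel.prod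

theorem tsum_oddKernel_two_mul (r : ℕ) :
    ∑' m, oddKernel (2 * r) m = 1 / 4 * ∑' m, oddKernel r m := by
  simp only [oddKernel_two_mul, tsum_mul_left]

theorem tsum_odd_tsum_oddKernel : ∑' k, ∑' m, oddKernel (2 * k + 1) m = 1 := by
  have hinj : Function.Injective fun k : ℕ => 2 * k + 1 := fun a b h => by
    simpa using h
  have hsupp : Function.support (fun r => ∑' m, oddOddKernel (r, m)) ⊆
      Set.range fun k : ℕ => 2 * k + 1 := by
    intro r hr
    have hr : Odd r := by
      by_contra h
      simp [oddOddKernel, h] at hr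
    obtain ⟨k, rfl⟩ := hr
    exact ⟨k, rfl⟩
  rw [← tsum_oddOddKernel, summable_oddOddKernel.tsum_prod, ← hinj.tsum_eq hsupp]
  exact tsum_congr fun k => tsum_congr fun m => by simp [oddOddKernel]

theorem tsum_tsum_oddKernel : ∑' r, ∑' m, oddKernel r m = 4 / 3 := by
  have h2 : Function.Injective fun k : ℕ => 2 * k := fun a b h => by simpa using h
  have h21 : Function.Injective fun k : ℕ => 2 * k + 1 := fun a b h => by simpa using h
  have h := tsum_even_add_odd (f := fun r => ∑' m, oddKernel r m)
    (summable_tsum_oddKernel.comp_injective h2)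
    (summable_tsum_oddKernel.comp_injective h21)
  rw [tsum_odd_tsum_oddKernel] at h
  simp only [tsum_oddKernel_two_mul, tsum_mul_left] at h
  linarith

theorem tsum_oddKernel_two_mul_add_one (r : ℕ) :
    ∑' k, oddKernel r (2 * k + 1) = ∑' m, oddKernel r m := by
  have h21 : Function.Injective fun k : ℕ => 2 * k + 1 := fun a b h => by simpa using h
  refine h21.tsum_eq fun m hm => ?_
  have hm : Odd m := by
    by_contra h
    simp [oddKernel, h] at hm
  obtain ⟨k, rfl⟩ := hm
  exact ⟨k, rfl⟩

theorem totient_mul_two_pow_succ (n t : ℕ) :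
    (n * 2 ^ (t + 1)).totient = 2 ^ t * (2 * n).totient := by
  induction t with
  | zero => simp [mul_comm]
  | succ t ih =>
    rw [show n * 2 ^ (t + 1 + 1) = 2 * (n * 2 ^ (t + 1)) by ring,
      Nat.totient_two_mul_of_even ((even_two.pow_of_ne_zero t.succ_ne_zero).mul_left n), ih]
    ring

theorem Nat.lcm_two_pow_of_odd {m : ℕ} (hm : Odd m) (s : ℕ) : m.lcm (2 ^ s) = m * 2 ^ s :=
  (Nat.Coprime.pow_right s hm.coprime_two_right).lcm_eq_mul

theorem Nat.lcm_two_mul_two_pow_succ_of_odd {m : ℕ} (hm : Odd m) (t : ℕ) :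
    (2 * m).lcm (2 ^ (t + 1)) = m * 2 ^ (t + 1) := by
  rw [_root_.pow_succ', Nat.lcm_mul_left, Nat.lcm_two_pow_of_odd hm]
  ring

theorem moebius_div_eq_oddKernel {m : ℕ} (hm : Odd m) (r t : ℕ) :
    (ArithmeticFunction.moebius m : ℝ) /
      ((m : ℝ) * (r : ℝ) * (Nat.totient (r * Nat.lcm m (2 ^ (t + 1))) : ℝ)) =
      (2 ^ t)⁻¹ * oddKernel r m := by
  rw [Nat.lcm_two_pow_of_odd hm, ← mul_assoc, totient_mul_two_pow_succ, oddKernel, if_pos hm,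
    inv_mul_eq_div, div_div]
  push_cast
  congr 1
  ring

theorem moebius_two_mul_div_eq_oddKernel (r m t : ℕ) :
    (ArithmeticFunction.moebius (2 * m) : ℝ) /
      (((2 * m : ℕ) : ℝ) * (r : ℝ) * (Nat.totient (r * Nat.lcm (2 * m) (2 ^ (t + 1))) : ℝ)) =
      (2 ^ t)⁻¹ * (-1 / 2 * oddKernel r m) := by
  by_cases hm : Odd m
  · have hmu : ArithmeticFunction.moebius (2 * m) = -ArithmeticFunction.moebius m := by
      rw [ArithmeticFunction.isMultiplicative_moebius.map_mul_of_coprime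
        hm.coprime_two_left, ArithmeticFunction.moebius_apply_prime Nat.prime_two, neg_one_mul]
    rw [mul_left_comm, ← moebius_div_eq_oddKernel hm r t, hmu,
      Nat.lcm_two_mul_two_pow_succ_of_odd hm, Nat.lcm_two_pow_of_odd hm, div_mul_div_comm]
    push_cast
    rw [neg_one_mul]
    congr 1
    ring
  · have hmu : ArithmeticFunction.moebius (2 * m) = 0 := by
      refine ArithmeticFunction.moebius_eq_zero_of_not_squarefree fun h => ?_
      obtain ⟨k, rfl⟩ := (Nat.not_odd_iff_even.1 hm).two_dvd
      exact absurd (h 2 ⟨k, by ring⟩) (by simp)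
    simp [hmu, oddKernel, hm]

theorem Int.gcd_two_pow_succ_eq_one_iff (x : ℤ) (t : ℕ) :
    Int.gcd x ((2 ^ (t + 1) : ℕ) : ℤ) = 1 ↔ Odd x := by
  rw [← Int.isCoprime_iff_gcd_eq_one]
  push_cast
  rw [IsCoprime.pow_right_iff t.succ_pos, Int.isCoprime_iff_gcd_eq_one, Int.gcd_comm]
  exact Int.isCoprime_iff_gcd_eq_one.symm.trans Int.isCoprime_two_left

theorem Int.gcd_two_pow_succ_dvd_odd_iff {a : ℤ} (ha : Odd a) (m t : ℕ) :
    (Nat.gcd m (2 ^ (t + 1)) : ℤ) ∣ a ↔ Odd m := by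
  refine ⟨fun h => ?_, fun h => ?_⟩
  · by_contra hm
    have h2 : 2 ∣ Nat.gcd m (2 ^ (t + 1)) :=
      Nat.dvd_gcd (Nat.not_odd_iff_even.1 hm).two_dvd (dvd_pow_self 2 t.succ_ne_zero)
    exact Int.not_even_iff_odd.2 ha
      (even_iff_two_dvd.2 ((Int.natCast_dvd_natCast.2 h2).trans h))
  · rw [Nat.Coprime.pow_right (t + 1) h.coprime_two_right]
    simp

theorem deltaDensity_term_odd {a : ℤ} (ha : Odd a) (t r m : ℕ) :
    (if 1 ≤ r ∧ 1 ≤ m ∧ Int.gcd (1 + (r : ℤ) * a) ((2 ^ (t + 1) : ℕ) : ℤ) = 1 ∧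
        ((Nat.gcd m (2 ^ (t + 1)) : ℤ) ∣ a) then
      (ArithmeticFunction.moebius m : ℝ) /
        ((m : ℝ) * (r : ℝ) * (Nat.totient (r * Nat.lcm m (2 ^ (t + 1))) : ℝ))
    else 0) = (2 ^ t)⁻¹ * if Even r then oddKernel r m else 0 := by
  have hodd : Odd (1 + (r : ℤ) * a) ↔ Even r := by
    rw [Int.odd_add]
    simp [Int.even_mul, ha]
  simp only [Int.gcd_two_pow_succ_eq_one_iff, Int.gcd_two_pow_succ_dvd_odd_iff ha, hodd]
  by_cases hm : Odd m
  · rw [moebius_div_eq_oddKernel hm]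
    rcases Nat.eq_zero_or_pos r with rfl | hr
    · simp [oddKernel]
    · simp [hm, Nat.one_le_iff_ne_zero, hm.pos.ne', hr.ne']
  · simp [hm, oddKernel]

theorem deltaDensity_term_even {a : ℤ} (ha : Even a) (t r m : ℕ) :
    (if 1 ≤ r ∧ 1 ≤ m ∧ Int.gcd (1 + (r : ℤ) * a) ((2 ^ (t + 1) : ℕ) : ℤ) = 1 ∧
        ((Nat.gcd m (2 ^ (t + 1)) : ℤ) ∣ a) then
      (ArithmeticFunction.moebius m : ℝ) /
        ((m : ℝ) * (r : ℝ) * (Nat.totient (r * Nat.lcm m (2 ^ (t + 1))) : ℝ))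
    else 0) = (ArithmeticFunction.moebius m : ℝ) /
        ((m : ℝ) * (r : ℝ) * (Nat.totient (r * Nat.lcm m (2 ^ (t + 1))) : ℝ)) := by
  split_ifs with h
  · rfl
  by_cases hr : r = 0
  · simp [hr]
  by_cases hm : m = 0
  · simp [hm]
  by_cases hsq : Squarefree m
  · refine absurd ⟨Nat.one_le_iff_ne_zero.2 hr, Nat.one_le_iff_ne_zero.2 hm, ?_, ?_⟩ h
    · rw [Int.gcd_two_pow_succ_eq_one_iff]
      exact odd_one.add_even (ha.mul_left _)
    · have h2 : Nat.gcd m (2 ^ (t + 1)) ∣ 2 :=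
        ((hsq.squarefree_of_dvd (Nat.gcd_dvd_left _ _)).dvd_pow_iff_dvd t.succ_ne_zero).1
          (Nat.gcd_dvd_right _ _)
      exact (Int.natCast_dvd_natCast.2 h2).trans ha.two_dvd
  · simp [ArithmeticFunction.moebius_eq_zero_of_not_squarefree hsq]

theorem deltaDensity_two_pow_succ_of_odd {a : ℤ} (ha : Odd a) (t : ℕ) :
    deltaDensity a (2 ^ (t + 1)) = (2 ^ t)⁻¹ / 3 := by
  have hinj : Function.Injective fun k : ℕ => 2 * k := fun a b h => by simpa using h
  have hsupp : Function.support (fun r => ∑' m, if Even r then oddKernel r m else 0) ⊆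
      Set.range fun k : ℕ => 2 * k := by
    intro r hr
    have hr : Even r := by
      by_contra h
      simp [h] at hr
    obtain ⟨k, rfl⟩ := hr.two_dvd
    exact ⟨k, rfl⟩
  unfold deltaDensity
  simp only [deltaDensity_term_odd ha, tsum_mul_left]
  rw [← hinj.tsum_eq hsupp]
  simp only [even_two_mul, if_true, tsum_oddKernel_two_mul, tsum_mul_left, tsum_tsum_oddKernel]
  ring

theorem deltaDensity_two_pow_succ_of_even {a : ℤ} (ha : Even a) (t : ℕ) :
    deltaDensity a (2 ^ (t + 1)) = 2 * (2 ^ t)⁻¹ / 3 := by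
  have hinj : Function.Injective fun k : ℕ => 2 * k + 1 := fun a b h => by simpa using h
  have hinner (r : ℕ) : ∑' m : ℕ, (ArithmeticFunction.moebius m : ℝ) /
      ((m : ℝ) * (r : ℝ) * (Nat.totient (r * Nat.lcm m (2 ^ (t + 1))) : ℝ)) =
      (2 ^ t)⁻¹ * (1 / 2 * ∑' m, oddKernel r m) := by
    rw [← tsum_even_add_odd]
    · simp only [moebius_two_mul_div_eq_oddKernel,
        moebius_div_eq_oddKernel (odd_two_mul_add_one _), tsum_mul_left,
        tsum_oddKernel_two_mul_add_one]
      ring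
    · simp only [moebius_two_mul_div_eq_oddKernel]
      exact ((summable_oddKernel_left r).mul_left _).mul_left _
    · simp only [moebius_div_eq_oddKernel (odd_two_mul_add_one _)]
      exact ((summable_oddKernel_left r).comp_injective hinj).mul_left _
  unfold deltaDensity
  simp only [deltaDensity_term_even ha, hinner, tsum_mul_left, tsum_tsum_oddKernel]
  ring

/-- For `s ≥ 1`: `δ(a,2^s) = 2^{2−s}/3` if `a` is even, and `δ(a,2^s) = 2^{1−s}/3`
if `a` is odd. -/
theorem deltaDensity_two_pow (s : ℕ) (hs : 1 ≤ s) (a : ℤ) :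
    (Even a → deltaDensity a (2 ^ s) = (2 : ℝ) ^ ((2 : ℤ) - (s : ℤ)) / 3) ∧
    (Odd a → deltaDensity a (2 ^ s) = (2 : ℝ) ^ ((1 : ℤ) - (s : ℤ)) / 3) := by
  obtain ⟨t, rfl⟩ : ∃ t, s = t + 1 := ⟨s - 1, by omega⟩
  refine ⟨fun ha => ?_, fun ha => ?_⟩
  · rw [deltaDensity_two_pow_succ_of_even ha,
      show (2 : ℤ) - ((t + 1 : ℕ) : ℤ) = 1 + -(t : ℤ) by push_cast; ring,
      zpow_add₀ two_ne_zero, zpow_one, zpow_neg, zpow_natCast]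
  · rw [deltaDensity_two_pow_succ_of_odd ha,
      show (1 : ℤ) - ((t + 1 : ℕ) : ℤ) = -(t : ℤ) by push_cast; ring,
      zpow_neg, zpow_natCast]
end

section
/- For every real number x ≥ 6 one has Σ_{n > x} 1/(n·φ(n)) < 2.1/x, where the sum is over all integers n > x. -/
open Finset

/-- The function `μ(e)² / φ(e)`, whose divisor sum is `n / φ(n)`. -/
noncomputable def sqfreeInvTotient (e : ℕ) : ℝ := if Squarefree e then 1 / (e.totient : ℝ) else 0

lemma sqfreeInvTotient_nonneg (e : ℕ) : 0 ≤ sqfreeInvTotient e := by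
  unfold sqfreeInvTotient
  split_ifs <;> positivity

lemma prod_primeFactors_one_add_inv_totient {r : ℕ} (hr : Squarefree r) :
    ∏ p ∈ r.primeFactors, (1 + 1 / (p.totient : ℝ)) = ∑ d ∈ r.divisors, 1 / (d.totient : ℝ) := by
  let f : ArithmeticFunction ℝ := ⟨fun n => 1 / (n.totient : ℝ), by simp⟩
  have hf : f.IsMultiplicative := by
    rw [ArithmeticFunction.IsMultiplicative.iff_ne_zero]
    refine ⟨by simp [f], fun {m n} _ _ hmn => ?_⟩
    change 1 / ((m * n).totient : ℝ) = 1 / (m.totient : ℝ) * (1 / (n.totient : ℝ))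
    rw [Nat.totient_mul hmn]
    push_cast
    rw [one_div_mul_one_div]
  exact hf.prodPrimeFactors_one_add_of_squarefree hr

lemma div_totient_eq_prod_primeFactors {n : ℕ} (hn : n ≠ 0) :
    (n : ℝ) / n.totient = ∏ p ∈ n.primeFactors, (1 + 1 / (p.totient : ℝ)) := by
  have htot : (n.totient : ℝ) = n * ∏ p ∈ n.primeFactors, (1 - (p : ℝ)⁻¹) := by
    have h := congrArg (Rat.cast : ℚ → ℝ) (Nat.totient_eq_mul_prod_factors n)
    push_cast at h
    exact h
  have hn' : (n : ℝ) ≠ 0 := by exact_mod_cast hn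
  rw [htot, div_mul_cancel_left₀ hn', ← Finset.prod_inv_distrib]
  refine Finset.prod_congr rfl fun p hp => ?_
  have hp' := Nat.prime_of_mem_primeFactors hp
  have h1 : (1 : ℝ) < p := by exact_mod_cast hp'.one_lt
  rw [Nat.totient_prime hp', Nat.cast_sub hp'.one_lt.le, Nat.cast_one]
  have h2 : (p : ℝ) - 1 ≠ 0 := by linarith
  have h3 : (p : ℝ) ≠ 0 := by linarith
  have h4 : 1 - (p : ℝ)⁻¹ ≠ 0 := by
    have : 1 - (p : ℝ)⁻¹ = (p - 1) / p := by field_simp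
    rw [this]
    exact div_ne_zero h2 h3
  rw [inv_eq_one_div, div_eq_iff h4]
  field_simp
  ring

lemma div_totient_le_sum_divisors {n : ℕ} (hn : n ≠ 0) :
    (n : ℝ) / n.totient ≤ ∑ e ∈ n.divisors, sqfreeInvTotient e := by
  have hr : Squarefree (UniqueFactorizationMonoid.radical n) :=
    UniqueFactorizationMonoid.squarefree_radical
  rw [div_totient_eq_prod_primeFactors hn, ← Nat.primeFactors_radical n,
    prod_primeFactors_one_add_inv_totient hr]
  calc _ = ∑ d ∈ (UniqueFactorizationMonoid.radical n).divisors, sqfreeInvTotient d := by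
        refine Finset.sum_congr rfl fun d hd => ?_
        rw [sqfreeInvTotient, if_pos (hr.squarefree_of_dvd (Nat.dvd_of_mem_divisors hd))]
    _ ≤ _ := Finset.sum_le_sum_of_subset_of_nonneg
        (Nat.divisors_subset_of_dvd hn UniqueFactorizationMonoid.radical_dvd_self)
        fun d _ _ => sqfreeInvTotient_nonneg d

lemma sum_Ioc_one_div_sq_le (M L : ℕ) :
    ∑ m ∈ Ioc M L, 1 / (m : ℝ) ^ 2 ≤ 2 / (2 * (M : ℝ) + 1) := by
  rcases le_total L M with h | h
  · rw [Ioc_eq_empty_of_le h, sum_empty]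
    positivity
  · suffices ∑ m ∈ Ioc M L, 1 / (m : ℝ) ^ 2 ≤ 2 / (2 * (M : ℝ) + 1) - 2 / (2 * (L : ℝ) + 1) by
      have : (0 : ℝ) ≤ 2 / (2 * (L : ℝ) + 1) := by positivity
      linarith
    induction L, h using Nat.le_induction with
    | base => simp
    | succ L h ih =>
      rw [sum_Ioc_succ_top h]
      have : 1 / ((L + 1 : ℕ) : ℝ) ^ 2 ≤ 2 / (2 * (L : ℝ) + 1) - 2 / (2 * ((L + 1 : ℕ) : ℝ) + 1) := by
        push_cast
        rw [div_sub_div _ _ (by positivity) (by positivity),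
          div_le_div_iff₀ (by positivity) (by positivity)]
        nlinarith
      linarith

lemma sum_Ioc_filter_dvd {e : ℕ} (he : 0 < e) (N L : ℕ) :
    ∑ n ∈ Ioc N L with e ∣ n, 1 / (n : ℝ) ^ 2 =
      1 / (e : ℝ) ^ 2 * ∑ m ∈ Ioc (N / e) (L / e), 1 / (m : ℝ) ^ 2 := by
  have himage : (Ioc N L).filter (e ∣ ·) = (Ioc (N / e) (L / e)).image (e * ·) := by
    ext n
    simp only [mem_filter, mem_Ioc, mem_image]
    constructor
    · rintro ⟨⟨h1, h2⟩, m, rfl⟩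
      refine ⟨m, ⟨?_, ?_⟩, rfl⟩
      · rwa [Nat.div_lt_iff_lt_mul he, mul_comm]
      · rwa [Nat.le_div_iff_mul_le he, mul_comm]
    · rintro ⟨m, ⟨h1, h2⟩, rfl⟩
      rw [Nat.div_lt_iff_lt_mul he, mul_comm] at h1
      rw [Nat.le_div_iff_mul_le he, mul_comm] at h2
      exact ⟨⟨h1, h2⟩, dvd_mul_right e m⟩
  rw [himage, sum_image fun a _ b _ hab => Nat.eq_of_mul_eq_mul_left he hab, mul_sum]
  refine sum_congr rfl fun m _ => ?_
  push_cast
  rw [one_div_mul_one_div, mul_pow]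

lemma sum_Ioc_one_div_mul_totient_le (N L : ℕ) :
    ∑ n ∈ Ioc N L, 1 / ((n : ℝ) * n.totient) ≤
      ∑ e ∈ Ioc 0 L, sqfreeInvTotient e / (e : ℝ) ^ 2 * (2 / (2 * ((N / e : ℕ) : ℝ) + 1)) := by
  calc ∑ n ∈ Ioc N L, 1 / ((n : ℝ) * n.totient)
      ≤ ∑ n ∈ Ioc N L, ∑ e ∈ Ioc 0 L,
          if e ∣ n then sqfreeInvTotient e * (1 / (n : ℝ) ^ 2) else 0 := by
        refine sum_le_sum fun n hn => ?_
        rw [mem_Ioc] at hn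
        have hn0 : n ≠ 0 := by omega
        have hdiv : (Ioc 0 L).filter (· ∣ n) = n.divisors := by
          ext d
          simp only [mem_filter, mem_Ioc, Nat.mem_divisors]
          exact ⟨fun h => ⟨h.2, hn0⟩, fun h => ⟨⟨Nat.pos_of_dvd_of_pos h.1 (by omega),
            (Nat.le_of_dvd (by omega) h.1).trans hn.2⟩, h.1⟩⟩
        rw [← sum_filter, hdiv, ← sum_mul]
        have h := mul_le_mul_of_nonneg_right (div_totient_le_sum_divisors hn0)
          (by positivity : (0 : ℝ) ≤ 1 / (n : ℝ) ^ 2)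
        refine le_trans (le_of_eq ?_) h
        have : (n : ℝ) ≠ 0 := by exact_mod_cast hn0
        have : (n.totient : ℝ) ≠ 0 := by
          exact_mod_cast (Nat.totient_pos.2 (Nat.pos_of_ne_zero hn0)).ne'
        field_simp
    _ = ∑ e ∈ Ioc 0 L, sqfreeInvTotient e * ∑ n ∈ Ioc N L with e ∣ n, 1 / (n : ℝ) ^ 2 := by
        rw [sum_comm]
        refine sum_congr rfl fun e _ => ?_
        rw [← sum_filter, mul_sum]
    _ ≤ _ := by
        refine sum_le_sum fun e he => ?_
        rw [sum_Ioc_filter_dvd (mem_Ioc.1 he).1, ← mul_assoc, mul_one_div]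
        have := sqfreeInvTotient_nonneg e
        exact mul_le_mul_of_nonneg_left (sum_Ioc_one_div_sq_le _ _) (by positivity)

lemma add_one_le_mul_div_add_one {e : ℕ} (he : 0 < e) (N : ℕ) :
    (N : ℝ) + 1 ≤ e * (((N / e : ℕ) : ℝ) + 1) := by
  have := Nat.lt_mul_div_succ N he
  exact_mod_cast this

lemma weight_le_two_mul {e : ℕ} (he : 0 < e) (N : ℕ) :
    sqfreeInvTotient e / (e : ℝ) ^ 2 * (2 / (2 * ((N / e : ℕ) : ℝ) + 1)) ≤
      2 / (N + 1) * (sqfreeInvTotient e / e) := by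
  have h := add_one_le_mul_div_add_one he N
  have he' : (0 : ℝ) < e := by exact_mod_cast he
  have hg := sqfreeInvTotient_nonneg e
  have hq : (0 : ℝ) ≤ e * ((N / e : ℕ) : ℝ) := by positivity
  have key : 1 / (e : ℝ) * (2 / (2 * ((N / e : ℕ) : ℝ) + 1)) ≤ 2 / (N + 1) := by
    rw [div_mul_div_comm, div_le_div_iff₀ (by positivity) (by positivity)]
    nlinarith
  calc _ = 1 / (e : ℝ) * (2 / (2 * ((N / e : ℕ) : ℝ) + 1)) * (sqfreeInvTotient e / e) := by
        field_simp
    _ ≤ _ := mul_le_mul_of_nonneg_right key (by positivity)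

lemma weight_le_of_le_hundred {e N : ℕ} (he : 0 < e) (he100 : e ≤ 100) (hN : 100 ≤ N) :
    sqfreeInvTotient e / (e : ℝ) ^ 2 * (2 / (2 * ((N / e : ℕ) : ℝ) + 1)) ≤
      1 / (N + 1) * (202 / (202 - e) * (sqfreeInvTotient e / e)) := by
  have h := add_one_le_mul_div_add_one he N
  have he' : (0 : ℝ) < e := by exact_mod_cast he
  have he100' : (e : ℝ) ≤ 100 := by exact_mod_cast he100
  have hN' : (100 : ℝ) ≤ N := by exact_mod_cast hN
  have hg := sqfreeInvTotient_nonneg e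
  have h202 : (0 : ℝ) < 202 - e := by linarith
  have key : 1 / (e : ℝ) * (2 / (2 * ((N / e : ℕ) : ℝ) + 1)) ≤ 1 / (N + 1) * (202 / (202 - e)) := by
    rw [div_mul_div_comm, div_mul_div_comm, div_le_div_iff₀ (by positivity) (by positivity)]
    nlinarith [mul_nonneg he'.le (by linarith : (0 : ℝ) ≤ N - 100)]
  calc _ = 1 / (e : ℝ) * (2 / (2 * ((N / e : ℕ) : ℝ) + 1)) * (sqfreeInvTotient e / e) := by
        field_simp
    _ ≤ 1 / (N + 1) * (202 / (202 - e)) * (sqfreeInvTotient e / e) :=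
        mul_le_mul_of_nonneg_right key (by positivity)
    _ = _ := mul_assoc _ _ _

lemma sqfreeInvTotient_div_le (e : ℕ) :
    sqfreeInvTotient e / e ≤
      ((if ¬ 4 ∣ e ∧ ¬ 9 ∣ e ∧ ¬ 25 ∣ e then 1 / ((e : ℚ) * e.totient) else 0 : ℚ) : ℝ) := by
  unfold sqfreeInvTotient
  by_cases h : Squarefree e
  · have hnot (p : ℕ) (hp : p ≠ 1) : ¬ p * p ∣ e := fun hd => hp (Nat.isUnit_iff.1 (h p hd))
    rw [if_pos h, if_pos ⟨hnot 2 (by norm_num), hnot 3 (by norm_num), hnot 5 (by norm_num)⟩]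
    push_cast
    rw [div_div, mul_comm]
  · rw [if_neg h, zero_div]
    split_ifs <;> positivity

lemma sum_sqfreeInvTotient_div_le_hundred :
    ∑ e ∈ Ioc (0 : ℕ) 100, sqfreeInvTotient e / e ≤ (1.935 : ℝ) := by
  have h : ∑ e ∈ Ioc (0 : ℕ) 100,
      (if ¬ 4 ∣ e ∧ ¬ 9 ∣ e ∧ ¬ 25 ∣ e then 1 / ((e : ℚ) * e.totient) else 0) ≤ 1935 / 1000 := by
    decide +kernel
  have h' := (Rat.cast_le (K := ℝ)).2 h
  rw [Rat.cast_sum] at h'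
  refine (sum_le_sum fun e _ => sqfreeInvTotient_div_le e).trans (h'.trans ?_)
  norm_num

lemma weighted_sum_sqfreeInvTotient_div_le_hundred :
    ∑ e ∈ Ioc (0 : ℕ) 100, 202 / (202 - (e : ℝ)) * (sqfreeInvTotient e / e) ≤ 1.968 := by
  have h : ∑ e ∈ Ioc (0 : ℕ) 100, 202 / (202 - (e : ℚ)) *
      (if ¬ 4 ∣ e ∧ ¬ 9 ∣ e ∧ ¬ 25 ∣ e then 1 / ((e : ℚ) * e.totient) else 0) ≤ 1968 / 1000 := by
    decide +kernel
  have h' := (Rat.cast_le (K := ℝ)).2 h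
  rw [Rat.cast_sum] at h'
  refine (sum_le_sum fun e he => ?_).trans (h'.trans (by norm_num))
  have he : (e : ℝ) ≤ 100 := by exact_mod_cast (mem_Ioc.1 he).2
  rw [Rat.cast_mul]
  simp only [Rat.cast_div, Rat.cast_sub, Rat.cast_natCast, Rat.cast_ofNat]
  exact mul_le_mul_of_nonneg_left (sqfreeInvTotient_div_le e)
    (div_nonneg (by norm_num) (by linarith))

lemma sum_Ioc_hundred_sqfreeInvTotient_div_le {L : ℕ} (hL : 100 ≤ L) :
    ∑ e ∈ Ioc 100 L, sqfreeInvTotient e / e ≤ 0.0391 := by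
  have hsplit : ∑ e ∈ Ioc 0 L, sqfreeInvTotient e / e =
      ∑ e ∈ Ioc (0 : ℕ) 100, sqfreeInvTotient e / e + ∑ e ∈ Ioc 100 L, sqfreeInvTotient e / e :=
    (sum_Ioc_consecutive _ (by norm_num) hL).symm
  have h1 : ∑ e ∈ Ioc 100 L, sqfreeInvTotient e / e ≤
      ∑ n ∈ Ioc 100 L, 1 / ((n : ℝ) * n.totient) := by
    refine sum_le_sum fun e _ => ?_
    unfold sqfreeInvTotient
    split_ifs
    · rw [div_div, mul_comm]
    · rw [zero_div]
      positivity
  have h2 : ∑ n ∈ Ioc 100 L, 1 / ((n : ℝ) * n.totient) ≤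
      2 / 101 * ∑ e ∈ Ioc 0 L, sqfreeInvTotient e / e := by
    refine (sum_Ioc_one_div_mul_totient_le 100 L).trans ?_
    rw [mul_sum]
    refine sum_le_sum fun e he => (weight_le_two_mul (mem_Ioc.1 he).1 100).trans_eq ?_
    norm_num
  have h3 := sum_sqfreeInvTotient_div_le_hundred
  linarith

lemma sum_Ioc_one_div_mul_totient_le_of_hundred_le {N : ℕ} (hN : 100 ≤ N) (L : ℕ) :
    ∑ n ∈ Ioc N L, 1 / ((n : ℝ) * n.totient) ≤ 2.05 / ((N : ℝ) + 1) := by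
  rcases le_total L N with hLN | hNL
  · rw [Ioc_eq_empty_of_le hLN, sum_empty]
    positivity
  have hL : 100 ≤ L := hN.trans hNL
  have hsmall : ∑ e ∈ Ioc (0 : ℕ) 100, sqfreeInvTotient e / (e : ℝ) ^ 2 * (2 / (2 * ((N / e : ℕ) : ℝ) + 1)) ≤
      1 / ((N : ℝ) + 1) * 1.968 := by
    refine (sum_le_sum fun e he =>
      weight_le_of_le_hundred (mem_Ioc.1 he).1 (mem_Ioc.1 he).2 hN).trans ?_
    rw [← mul_sum]
    exact mul_le_mul_of_nonneg_left weighted_sum_sqfreeInvTotient_div_le_hundred (by positivity)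
  have hlarge : ∑ e ∈ Ioc 100 L, sqfreeInvTotient e / (e : ℝ) ^ 2 * (2 / (2 * ((N / e : ℕ) : ℝ) + 1)) ≤
      2 / ((N : ℝ) + 1) * 0.0391 := by
    refine (sum_le_sum fun e he =>
      weight_le_two_mul ((Nat.zero_le 100).trans_lt (mem_Ioc.1 he).1) N).trans ?_
    rw [← mul_sum]
    exact mul_le_mul_of_nonneg_left (sum_Ioc_hundred_sqfreeInvTotient_div_le hL) (by positivity)
  refine (sum_Ioc_one_div_mul_totient_le N L).trans ?_
  rw [← sum_Ioc_consecutive _ (Nat.zero_le 100) hL]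
  refine (add_le_add hsmall hlarge).trans ?_
  rw [div_mul_eq_mul_div, div_mul_eq_mul_div, ← add_div]
  gcongr
  norm_num

/-- `TailSumsLE f b k s` checks that `s + ∑ n ∈ Ioc j k, f n ≤ b j` for every `j ≤ k`. -/
def TailSumsLE (f b : ℕ → ℚ) : ℕ → ℚ → Bool
  | 0, s => s ≤ b 0
  | k + 1, s => s ≤ b (k + 1) && TailSumsLE f b k (s + f (k + 1))

lemma add_sum_Ioc_le_of_tailSumsLE {f b : ℕ → ℚ} {k : ℕ} {s : ℚ} (h : TailSumsLE f b k s) {j : ℕ}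
    (hj : j ≤ k) : s + ∑ n ∈ Ioc j k, f n ≤ b j := by
  induction k generalizing s with
  | zero =>
    obtain rfl : j = 0 := by omega
    simpa [TailSumsLE] using h
  | succ k ih =>
    simp only [TailSumsLE, Bool.and_eq_true, decide_eq_true_eq] at h
    rcases hj.eq_or_lt with rfl | hj
    · simpa using h.1
    · have := ih h.2 (Nat.lt_succ_iff.1 hj)
      rw [sum_Ioc_succ_top (Nat.lt_succ_iff.1 hj)]
      linarith

lemma sum_Ioc_hundred_add_le {N : ℕ} (h6 : 6 ≤ N) (hN : N ≤ 100) :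
    (2.05 / 101 : ℝ) + ∑ n ∈ Ioc N 100, 1 / ((n : ℝ) * n.totient) ≤ 2.1 / ((N : ℝ) + 1) := by
  have h : TailSumsLE (fun n => 1 / (n * n.totient))
      (fun n => if n < 6 then 3 else 21 / 10 / (n + 1)) 100 (41 / 20 / 101) := by
    decide +kernel
  have h' := (Rat.cast_le (K := ℝ)).2 (add_sum_Ioc_le_of_tailSumsLE h hN)
  rw [if_neg (by omega)] at h'
  push_cast at h'
  norm_num at h' ⊢
  exact h'

lemma sum_Ioc_one_div_mul_totient_le_of_six_le {N : ℕ} (hN : 6 ≤ N) (L : ℕ) :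
    ∑ n ∈ Ioc N L, 1 / ((n : ℝ) * n.totient) ≤ 2.1 / ((N : ℝ) + 1) := by
  rcases le_total 100 N with h | h
  · refine (sum_Ioc_one_div_mul_totient_le_of_hundred_le h L).trans ?_
    gcongr
    norm_num
  · have htail := sum_Ioc_one_div_mul_totient_le_of_hundred_le le_rfl (max L 100)
    have hhead := sum_Ioc_hundred_add_le hN h
    have hmono : ∑ n ∈ Ioc N L, 1 / ((n : ℝ) * n.totient) ≤
        ∑ n ∈ Ioc N (max L 100), 1 / ((n : ℝ) * n.totient) :=
      sum_le_sum_of_subset_of_nonneg (Ioc_subset_Ioc_right (le_max_left _ _))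
        fun n _ _ => by positivity
    rw [← sum_Ioc_consecutive _ h (le_max_right _ _)] at hmono
    norm_num at htail hhead hmono ⊢
    linarith

/-- For every real `x ≥ 6` one has `Σ_{n > x} 1/(n·φ(n)) < 2.1/x`. -/
theorem tsum_one_div_mul_totient_lt (x : ℝ) (hx : 6 ≤ x) :
    (∑' n : ℕ, if x < (n : ℝ) then 1 / ((n : ℝ) * (Nat.totient n : ℝ)) else 0) <
      2.1 / x := by
  have hx0 : 0 ≤ x := by linarith
  have hfloor : 6 ≤ ⌊x⌋₊ := Nat.le_floor (by exact_mod_cast hx)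
  refine lt_of_le_of_lt (b := 2.1 / ((⌊x⌋₊ : ℝ) + 1)) (Real.tsum_le_of_sum_range_le
    (fun n => by split_ifs <;> positivity) fun L => ?_) ?_
  · rw [← sum_filter]
    refine (sum_le_sum_of_subset_of_nonneg (fun n hn => ?_) fun n _ _ => by positivity).trans
      (sum_Ioc_one_div_mul_totient_le_of_six_le hfloor L)
    rw [mem_filter, mem_range] at hn
    exact mem_Ioc.2 ⟨(Nat.floor_lt hx0).2 hn.2, hn.1.le⟩
  · exact div_lt_div_of_pos_left (by norm_num) (by linarith) (Nat.lt_floor_add_one x)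
end
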